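/- Let ψ_h (h ∈ ℕ) and ψ be metric dissipation functions, with conjugates ψ_h* and ψ*. Then ψ_h(v) → ψ(v) as h → ∞ for every v ∈ [0,∞) if and only if the following holds: for every w ∈ [0,∞) and every sequence (w_h) ⊂ [0,∞) with w_h → w, one has liminf_{h→∞} ψ_h(w_h) ≥ ψ(w) and liminf_{h→∞} ψ_h*(w_h) ≥ ψ*(w), where the liminf of the conjugates is taken in [0,∞]. -/

import Mathlib

open Filter Topology

/-- A metric dissipation function: `ψ : [0,∞) → [0,∞)` is convex, vanishes at `0`,
and `ψ(v)/v → L ∈ (0,∞]` as `v → ∞`. -/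
def IsDissipation (ψ : ℝ → ℝ) (L : ENNReal) : Prop :=
  ConvexOn ℝ (Set.Ici 0) ψ ∧ ψ 0 = 0 ∧ (∀ v ∈ Set.Ici (0:ℝ), 0 ≤ ψ v) ∧ 0 < L ∧
    Tendsto (fun v : ℝ => ENNReal.ofReal (ψ v / v)) atTop (𝓝 L)

/-- The conjugate `ψ*(f) = sup_{v ≥ 0} (f·v − ψ(v)) ∈ [0,∞]`. -/
noncomputable def conj (ψ : ℝ → ℝ) (f : ℝ) : ENNReal :=
  ⨆ v ∈ Set.Ici (0:ℝ), ENNReal.ofReal (f * v - ψ v)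

open Set in
/-- A convex function on a subset of `ℝ` has a supporting line at every interior point. -/
lemma ConvexOn.exists_supporting_slope {S : Set ℝ} {f : ℝ → ℝ} {x : ℝ} (hf : ConvexOn ℝ S f)
    (hx : x ∈ interior S) : ∃ p : ℝ, ∀ y ∈ S, f x + p * (y - x) ≤ f y := by
  refine ⟨derivWithin f (Ioi x) x, fun y hy => ?_⟩
  rcases lt_trichotomy y x with hyx | rfl | hxy
  · have h := (hf.slope_le_leftDeriv_of_mem_interior hy hx hyx).trans
      (hf.leftDeriv_le_rightDeriv_of_mem_interior hx)
    rw [slope_def_field, div_le_iff₀ (sub_pos.2 hyx)] at h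
    linarith
  · simp
  · have h := hf.rightDeriv_le_slope_of_mem_interior hx hy hxy
    rw [slope_def_field, le_div_iff₀ (sub_pos.2 hxy)] at h
    linarith

lemma ofReal_le_conj (ψ : ℝ → ℝ) (f : ℝ) {v : ℝ} (hv : 0 ≤ v) :
    ENNReal.ofReal (f * v - ψ v) ≤ conj ψ f :=
  le_iSup₂ (f := fun v (_ : v ∈ Set.Ici (0:ℝ)) => ENNReal.ofReal (f * v - ψ v)) v hv

lemma conj_le_ofReal {ψ : ℝ → ℝ} {f c : ℝ} (h : ∀ v, 0 ≤ v → f * v - ψ v ≤ c) :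
    conj ψ f ≤ ENNReal.ofReal c :=
  iSup₂_le fun v hv => ENNReal.ofReal_le_ofReal (h v hv)

/-- If `conj ψ w ≤ liminf conj (ψh h) (wh h)` and the approximating conjugates are frequently at
most `c ≥ 0`, then `c` bounds every competitor in the supremum defining `conj ψ w`. -/
lemma mul_sub_le_of_conj_le_liminf {ψh : ℕ → ℝ → ℝ} {ψ : ℝ → ℝ} {w c : ℝ} {wh : ℕ → ℝ}
    (hlim : conj ψ w ≤ liminf (fun h => conj (ψh h) (wh h)) atTop) (hc : 0 ≤ c)
    (hfreq : ∃ᶠ h in atTop, conj (ψh h) (wh h) ≤ ENNReal.ofReal c) {v : ℝ} (hv : 0 ≤ v) :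
    w * v - ψ v ≤ c :=
  (ENNReal.ofReal_le_ofReal_iff hc).1 <|
    (ofReal_le_conj ψ w hv).trans <| hlim.trans <| liminf_le_of_frequently_le' hfreq

/-- A sequence converging to `a` along a subsequence agrees along it with a sequence converging
to `a`; the modification can be taken to be `a` off the subsequence. -/
lemma StrictMono.tendsto_extend_const {X : Type*} [TopologicalSpace X] {φ : ℕ → ℕ}
    (hφ : StrictMono φ) {u : ℕ → X} {a : X} (hu : Tendsto u atTop (𝓝 a)) :
    Tendsto (Function.extend φ u fun _ => a) atTop (𝓝 a) := by
  intro s hs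
  obtain ⟨N, hN⟩ := eventually_atTop.1 (hu hs)
  refine eventually_atTop.2 ⟨φ N, fun h hh => ?_⟩
  by_cases hr : ∃ n, φ n = h
  · obtain ⟨n, rfl⟩ := hr
    simpa [hφ.injective.extend_apply] using hN n (hφ.le_iff_le.1 hh)
  · simpa [Function.extend_apply' _ _ _ hr] using mem_of_mem_nhds hs

namespace IsDissipation

variable {ψ : ℝ → ℝ} {L : ENNReal}

lemma nonneg (hψ : IsDissipation ψ L) {v : ℝ} (hv : 0 ≤ v) : 0 ≤ ψ v := hψ.2.2.1 v hv

/-- At every `v > 0` there is a supporting line of nonnegative slope. -/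
lemma exists_supporting_slope (hψ : IsDissipation ψ L) {v : ℝ} (hv : 0 < v) :
    ∃ p : ℝ, 0 ≤ p ∧ ∀ x, 0 ≤ x → ψ v + p * (x - v) ≤ ψ x := by
  obtain ⟨p, hp⟩ := hψ.1.exists_supporting_slope (by rwa [interior_Ici, Set.mem_Ioi])
  refine ⟨p, ?_, hp⟩
  have h0 := hp 0 Set.self_mem_Ici
  rw [hψ.2.1] at h0
  have := hψ.nonneg hv.le
  exact nonneg_of_mul_nonneg_left (by linarith : 0 ≤ p * v) hv

lemma monotoneOn (hψ : IsDissipation ψ L) : MonotoneOn ψ (Set.Ici 0) := by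
  intro u hu v _ huv
  rcases (Set.mem_Ici.1 hu).eq_or_lt with rfl | hu'
  · rw [hψ.2.1]; exact hψ.nonneg huv
  · obtain ⟨p, hp0, hp⟩ := hψ.exists_supporting_slope hu'
    have := hp v (hu'.le.trans huv)
    have := mul_nonneg hp0 (sub_nonneg.2 huv)
    linarith

end IsDissipation

section Convergence

variable {ψh : ℕ → ℝ → ℝ} {Lh : ℕ → ENNReal} {ψ : ℝ → ℝ} {L : ENNReal}

lemma ofReal_le_liminf_of_tendsto (hψh : ∀ h, IsDissipation (ψh h) (Lh h))
    (hψ : IsDissipation ψ L)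
    (hlim : ∀ v : ℝ, 0 ≤ v → Tendsto (fun h => ψh h v) atTop (𝓝 (ψ v)))
    {w : ℝ} (hw : 0 ≤ w) {wh : ℕ → ℝ} (hwh : Tendsto wh atTop (𝓝 w)) :
    ENNReal.ofReal (ψ w) ≤ liminf (fun h => ENNReal.ofReal (ψh h (wh h))) atTop := by
  rcases hw.eq_or_lt with rfl | hw
  · simp [hψ.2.1]
  have hcont : Tendsto (fun u => ENNReal.ofReal (ψ u)) (𝓝[<] w) (𝓝 (ENNReal.ofReal (ψ w))) := by
    have hc := hψ.1.continuousOn_interior.continuousAt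
      (isOpen_interior.mem_nhds (by rwa [interior_Ici, Set.mem_Ioi] : w ∈ interior (Set.Ici 0)))
    exact (ENNReal.continuous_ofReal.tendsto _).comp (hc.tendsto.mono_left nhdsWithin_le_nhds)
  refine le_of_tendsto hcont ?_
  filter_upwards [Ioo_mem_nhdsLT hw] with u ⟨hu0, huw⟩
  rw [← ((ENNReal.continuous_ofReal.tendsto _).comp (hlim u hu0.le)).liminf_eq]
  refine liminf_le_liminf ?_
  filter_upwards [hwh.eventually_const_lt huw] with h hh
  exact ENNReal.ofReal_le_ofReal ((hψh h).monotoneOn hu0.le (hu0.trans hh).le hh.le)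

lemma conj_le_liminf_of_tendsto
    (hlim : ∀ v : ℝ, 0 ≤ v → Tendsto (fun h => ψh h v) atTop (𝓝 (ψ v)))
    {w : ℝ} {wh : ℕ → ℝ} (hwh : Tendsto wh atTop (𝓝 w)) :
    conj ψ w ≤ liminf (fun h => conj (ψh h) (wh h)) atTop := by
  refine iSup₂_le fun v hv => ?_
  rw [← ((ENNReal.continuous_ofReal.tendsto _).comp
    ((hwh.mul_const v).sub (hlim v hv))).liminf_eq]
  exact liminf_le_liminf (Eventually.of_forall fun h => ofReal_le_conj (ψh h) (wh h) hv)

/-- Slopes of supporting lines at `v` stay bounded under the liminf inequality for the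
conjugates. -/
lemma eventually_supporting_slope_lt (hψh : ∀ h, IsDissipation (ψh h) (Lh h))
    (hψ : IsDissipation ψ L)
    (hconj : ∀ w : ℝ, 0 ≤ w → conj ψ w ≤ liminf (fun h => conj (ψh h) w) atTop)
    {v : ℝ} (hv : 0 < v) {p : ℕ → ℝ}
    (hp : ∀ h x, 0 ≤ x → ψh h v + p h * (x - v) ≤ ψh h x) :
    ∀ᶠ h in atTop, p h < ψ (v + 1) + 1 := by
  have hq : 0 ≤ ψ (v + 1) + 1 := by linarith [hψ.nonneg (by linarith : 0 ≤ v + 1)]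
  by_contra hcon
  have hfreq : ∃ᶠ h in atTop,
      conj (ψh h) (ψ (v + 1) + 1) ≤ ENNReal.ofReal ((ψ (v + 1) + 1) * v) := by
    refine (not_eventually.1 hcon).mono fun h hh => conj_le_ofReal fun x hx => ?_
    rw [not_lt] at hh
    rcases le_total x v with hxv | hvx
    · linarith [mul_le_mul_of_nonneg_left hxv hq, (hψh h).nonneg hx]
    · linarith [mul_le_mul_of_nonneg_right hh (sub_nonneg.2 hvx), hp h x hx,
        (hψh h).nonneg hv.le]
  have := mul_sub_le_of_conj_le_liminf (hconj _ hq) (mul_nonneg hq hv.le) hfreq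
    (by linarith : 0 ≤ v + 1)
  linarith

lemma eventually_lt_of_conj_le_liminf (hψh : ∀ h, IsDissipation (ψh h) (Lh h))
    (hψ : IsDissipation ψ L)
    (hconj : ∀ w : ℝ, 0 ≤ w → ∀ wh : ℕ → ℝ, (∀ h, 0 ≤ wh h) → Tendsto wh atTop (𝓝 w) →
      conj ψ w ≤ liminf (fun h => conj (ψh h) (wh h)) atTop)
    {v a : ℝ} (hv : 0 < v) (ha : ψ v < a) : ∀ᶠ h in atTop, ψh h v < a := by
  choose p hp0 hp using fun h => (hψh h).exists_supporting_slope hv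
  have hbdd := eventually_supporting_slope_lt hψh hψ
    (fun w hw => hconj w hw _ (fun _ => hw) tendsto_const_nhds) hv hp
  by_contra hcon
  obtain ⟨φ, hφ, hφp⟩ := extraction_of_frequently_atTop ((not_eventually.1 hcon).and_eventually hbdd)
  obtain ⟨r, -, θ, hθ, hr⟩ := tendsto_subseq_of_bounded (Metric.isBounded_Icc 0 (ψ (v + 1) + 1))
    (x := fun n => p (φ n)) fun n => ⟨hp0 _, (hφp n).2.le⟩
  have hφθ : StrictMono (φ ∘ θ) := hφ.comp hθ
  have ha_le : ∀ n, a ≤ ψh (φ (θ n)) v := fun n => not_lt.1 (hφp (θ n)).1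
  have hr0 : 0 ≤ r := ge_of_tendsto' hr fun n => hp0 _
  have har : a ≤ r * v := by
    refine ge_of_tendsto' (hr.mul_const v) fun n => (ha_le n).trans ?_
    have := hp (φ (θ n)) 0 le_rfl
    rw [(hψh _).2.1] at this
    simp only [Function.comp_apply]
    linarith
  have hlim := hφθ.tendsto_extend_const hr
  set wh := Function.extend (φ ∘ θ) ((fun n => p (φ n)) ∘ θ) fun _ => r
  have hwh : ∀ n, wh (φ (θ n)) = p (φ (θ n)) := fun n => hφθ.injective.extend_apply _ _ n
  have hwh0 : ∀ h, 0 ≤ wh h := fun h => by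
    by_cases hh : ∃ n, (φ ∘ θ) n = h
    · obtain ⟨n, rfl⟩ := hh
      exact (hp0 _).trans_eq (hwh n).symm
    · have hwr : wh h = r := Function.extend_apply' _ (fun _ => r) h hh
      exact hr0.trans_eq hwr.symm
  have hfreq : ∃ᶠ h in atTop,
      conj (ψh h) (wh h) ≤ ENNReal.ofReal (r * v - (ψ v + a) / 2) := by
    refine hφθ.tendsto_atTop.frequently (Eventually.frequently ?_)
    have hlt : r * v < r * v + (a - ψ v) / 2 := by linarith
    filter_upwards [(hr.mul_const v).eventually_lt_const hlt] with n hn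
    refine conj_le_ofReal fun x hx => ?_
    simp only [Function.comp_apply] at hn ⊢
    rw [hwh]
    linarith [hp (φ (θ n)) x hx, ha_le n]
  have := mul_sub_le_of_conj_le_liminf (hconj r hr0 wh hwh0 hlim) (by linarith) hfreq hv.le
  linarith

end Convergence

/-- For metric dissipation functions, pointwise convergence
`ψ_h(v) → ψ(v)` on `[0,∞)` holds if and only if for every `w ∈ [0,∞)` and every
nonnegative sequence `w_h → w` one has both `liminf ψ_h(w_h) ≥ ψ(w)` and
`liminf ψ_h*(w_h) ≥ ψ*(w)` (the latter in `[0,∞]`). -/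
theorem pointwise_iff_liminf_and_liminf_conj
    (ψh : ℕ → ℝ → ℝ) (Lh : ℕ → ENNReal) (ψ : ℝ → ℝ) (L : ENNReal)
    (hψh : ∀ h, IsDissipation (ψh h) (Lh h)) (hψ : IsDissipation ψ L) :
    (∀ v : ℝ, 0 ≤ v → Tendsto (fun h => ψh h v) atTop (𝓝 (ψ v))) ↔
      (∀ w : ℝ, 0 ≤ w → ∀ wh : ℕ → ℝ, (∀ h, 0 ≤ wh h) → Tendsto wh atTop (𝓝 w) →
        ENNReal.ofReal (ψ w) ≤ liminf (fun h => ENNReal.ofReal (ψh h (wh h))) atTop ∧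
        conj ψ w ≤ liminf (fun h => conj (ψh h) (wh h)) atTop) := by
  constructor
  · intro hlim w hw wh _ hwh
    exact ⟨ofReal_le_liminf_of_tendsto hψh hψ hlim hw hwh, conj_le_liminf_of_tendsto hlim hwh⟩
  · intro H v hv
    rcases hv.eq_or_lt with rfl | hv'
    · simp [hψ.2.1, fun h => (hψh h).2.1]
    refine tendsto_order.2 ⟨fun a ha => ?_, fun a ha => ?_⟩
    · rcases lt_or_ge a 0 with ha0 | ha0
      · exact Eventually.of_forall fun h => ha0.trans_le ((hψh h).nonneg hv)
      · have hliminf := (H v hv _ (fun _ => hv) tendsto_const_nhds).1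
        have hlt := (ENNReal.ofReal_lt_ofReal_iff_of_nonneg ha0).2 ha
        filter_upwards [eventually_lt_of_lt_liminf (hlt.trans_le hliminf)] with h hh
        exact (ENNReal.ofReal_lt_ofReal_iff_of_nonneg ha0).1 hh
    · exact eventually_lt_of_conj_le_liminf hψh hψ
        (fun w hw wh hwh0 hwh => (H w hw wh hwh0 hwh).2) hv' ha
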